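/- Let k be a field, B a commutative k-algebra, and J an ideal of B. Assume B = k[{a_{i,j} : i=1,…,r, j=1,…,N} ∪ U] where r ≥ 2, N ≥ 1, the a_{i,j} are elements of B satisfying a_{i₁,j}·a_{i₂,j} ∈ J for all 1 ≤ i₁ < i₂ ≤ r and j = 1,…,N, and U is a finite subset of J. Define A := k[{a_{1,j}+⋯+a_{r,j} : j=1,…,N}] + J. Then A is a finitely generated k-algebra. -/

import Mathlib

open scoped Pointwise

/-- The sum of a subalgebra and an ideal, as a subalgebra. -/
def Subalgebra.addIdeal {k B : Type*} [CommRing k] [CommRing B] [Algebra k B]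
    (S : Subalgebra k B) (J : Ideal B) : Subalgebra k B :=
  (S.map (Ideal.Quotient.mkₐ k J)).comap (Ideal.Quotient.mkₐ k J)

theorem Subalgebra.coe_addIdeal {k B : Type*} [CommRing k] [CommRing B] [Algebra k B]
    (S : Subalgebra k B) (J : Ideal B) :
    (S.addIdeal J : Set B) = (S : Set B) + (J : Set B) := by
  ext x
  simp only [Subalgebra.addIdeal, Subalgebra.coe_comap, Subalgebra.coe_map, Set.mem_preimage,
    Set.mem_image, SetLike.mem_coe, Ideal.Quotient.mkₐ_eq_mk, Set.mem_add]
  constructor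
  · rintro ⟨s, hs, h⟩
    exact ⟨s, hs, x - s, Ideal.Quotient.eq.mp h.symm, by ring⟩
  · rintro ⟨s, hs, y, hy, rfl⟩
    exact ⟨s, hs, Ideal.Quotient.eq.mpr (by simpa using hy)⟩

/-- If `B` is a finitely generated algebra generated by elements integral over a subalgebra `A`,
over a Noetherian base, then `A` is finitely generated. -/
theorem Subalgebra.fg_of_adjoin_finite_isIntegral {k B : Type*} [CommRing k] [IsNoetherianRing k]
    [CommRing B] [Algebra k B] (A : Subalgebra k B) {s : Set B} (hs : s.Finite)
    (hB : Algebra.adjoin k s = ⊤) (hint : ∀ x ∈ s, IsIntegral A x) : A.FG := by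
  have hfg : (⊤ : Subalgebra k B).FG := Subalgebra.fg_def.mpr ⟨s, hs, hB⟩
  have : Algebra.IsIntegral A B := by
    refine ⟨fun x => ?_⟩
    have hle : Algebra.adjoin k s ≤ (integralClosure A B).restrictScalars k :=
      Algebra.adjoin_le hint
    exact hle (hB ▸ Algebra.mem_top)
  have : Algebra.FiniteType k B := ⟨hfg⟩
  have : Algebra.FiniteType A B := Algebra.FiniteType.of_restrictScalars_finiteType k A B
  have : Module.Finite A B := Algebra.IsIntegral.finite
  exact A.fg_top.mp (fg_of_fg_of_fg k A B hfg Module.Finite.fg_top Subtype.val_injective)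

/-- An element `x` is integral over a subalgebra containing `s` and `x * (s - x)`. -/
theorem isIntegral_of_mul_sub_mem {k B : Type*} [CommRing k] [CommRing B] [Algebra k B]
    (A : Subalgebra k B) {x s : B} (hs : s ∈ A) (hx : x * (s - x) ∈ A) : IsIntegral A x := by
  refine ⟨Polynomial.X ^ 2 - Polynomial.C ⟨s, hs⟩ * Polynomial.X
    + Polynomial.C ⟨x * (s - x), hx⟩, by monicity!, ?_⟩
  simp only [Polynomial.eval₂_add, Polynomial.eval₂_sub, Polynomial.eval₂_mul,
    Polynomial.eval₂_pow, Polynomial.eval₂_X, Polynomial.eval₂_C, Subalgebra.algebraMap_mk,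
    Algebra.algebraMap_self, RingHom.id_apply]
  ring

/-- Lemma 2.1(ii): with `B = k[{a_{i,j}} ∪ U]`, `a_{i₁,j} a_{i₂,j} ∈ J` for `i₁ < i₂`,
`U ⊆ J` finite, and `A = k[{a_{1,j}+⋯+a_{r,j} : j}] + J`, `A` is a finitely generated `k`-algebra. -/
theorem stmt_1
    (k : Type) [Field k] (B : Type) [CommRing B] [Algebra k B]
    (J : Ideal B)
    {r N : ℕ} (hr : 2 ≤ r) (hN : 1 ≤ N)
    (a : Fin r → Fin N → B)
    (hprod : ∀ i₁ i₂ : Fin r, i₁ < i₂ → ∀ j : Fin N, a i₁ j * a i₂ j ∈ J)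
    (U : Finset B) (hU : (U : Set B) ⊆ (J : Set B))
    (hB : Algebra.adjoin k ((Set.range fun p : Fin r × Fin N => a p.1 p.2) ∪ ↑U) = ⊤)
    (A : Set B)
    (hA : A = ↑(Algebra.adjoin k (Set.range fun j : Fin N => ∑ i : Fin r, a i j))
      + (J : Set B)) :
    ∃ S : Finset B, (S : Set B) ⊆ A ∧
      ((Algebra.adjoin k (S : Set B) : Subalgebra k B) : Set B) = A := by
  classical
  set S := Algebra.adjoin k (Set.range fun j : Fin N => ∑ i : Fin r, a i j)
  rw [← S.coe_addIdeal J] at hA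
  have hmem : ∀ x, x ∈ S.addIdeal J ↔ x ∈ (S : Set B) + (J : Set B) := fun x => by
    rw [← S.coe_addIdeal J, SetLike.mem_coe]
  have hJ : ∀ x ∈ J, x ∈ S.addIdeal J := fun x hx =>
    (hmem x).mpr ⟨0, S.zero_mem, x, hx, zero_add x⟩
  have hSA : ∀ x ∈ S, x ∈ S.addIdeal J := fun x hx =>
    (hmem x).mpr ⟨x, hx, 0, J.zero_mem, add_zero x⟩
  have hfg : (S.addIdeal J).FG := by
    refine Subalgebra.fg_of_adjoin_finite_isIntegral _
      ((Set.finite_range _).union U.finite_toSet) hB ?_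
    rintro x (⟨⟨i, j⟩, rfl⟩ | hx)
    · refine isIntegral_of_mul_sub_mem _ (hSA _ (Algebra.subset_adjoin ⟨j, rfl⟩)) (hJ _ ?_)
      dsimp only
      rw [← Finset.add_sum_erase _ _ (Finset.mem_univ i), add_sub_cancel_left, Finset.mul_sum]
      refine J.sum_mem fun l hl => ?_
      rcases lt_or_gt_of_ne (Finset.ne_of_mem_erase hl) with h | h
      · rw [mul_comm]
        exact hprod l i h j
      · exact hprod i l h j
    · exact isIntegral_algebraMap (R := S.addIdeal J) (x := ⟨x, hJ x (hU hx)⟩)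
  obtain ⟨T, hT⟩ := hfg
  subst hA
  exact ⟨T, hT ▸ Algebra.subset_adjoin, by rw [hT]⟩
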